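/- Define f : (0,∞) → ℝ by f(λ) = 2λ·e^{−2λ} + e^{−λ}·√(3e^{−λ} + 1)·Σ_{k=2}^{∞} λᵏ√k / k!. Then f is monotone increasing on the interval (0, 4/3]. -/

import Mathlib

/-- The series `∑_{k=2}^∞ λᵏ √k / k!`. -/
noncomputable def erSeries (l : ℝ) : ℝ :=
  ∑' k : ℕ, l ^ (k + 2) * Real.sqrt ((k : ℝ) + 2) / (Nat.factorial (k + 2) : ℝ)

/-- The asymptotic bound `f(λ) = 2λe^{-2λ} + e^{-λ}√(3e^{-λ}+1) ∑_{k=2}^∞ λᵏ√k/k!`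
for the energy per vertex of a sparse Erdős–Rényi graph. -/
noncomputable def erBound (l : ℝ) : ℝ :=
  2 * l * Real.exp (-2 * l) +
    Real.exp (-l) * Real.sqrt (3 * Real.exp (-l) + 1) * erSeries l

/-- The weight `e^{-λ}√(3e^{-λ}+1)` multiplying the series in `erBound`. -/
noncomputable def erWeight (l : ℝ) : ℝ :=
  Real.exp (-l) * Real.sqrt (3 * Real.exp (-l) + 1)

lemma erWeight_nonneg (l : ℝ) : 0 ≤ erWeight l := by
  unfold erWeight; positivity

lemma exp_neg_le_erWeight (l : ℝ) : Real.exp (-l) ≤ erWeight l := by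
  have h : 1 ≤ Real.sqrt (3 * Real.exp (-l) + 1) :=
    Real.one_le_sqrt.2 (by linarith [Real.exp_pos (-l)])
  exact le_mul_of_one_le_right (Real.exp_pos _).le h

lemma exists_hasDerivAt_erWeight {l : ℝ} (hl : 0 ≤ l) :
    ∃ d, HasDerivAt erWeight d l ∧ -(11 / 8) * erWeight l ≤ d := by
  have hq : HasDerivAt (fun x : ℝ => Real.exp (-x)) (-Real.exp (-l)) l := by
    simpa using (hasDerivAt_neg l).exp
  have hpos := Real.exp_pos (-l)
  have hs := ((hq.const_mul 3).add_const 1).sqrt (by positivity)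
  refine ⟨_, hq.mul hs, ?_⟩
  have hq1 : Real.exp (-l) ≤ 1 := Real.exp_le_one_iff.2 (by linarith)
  unfold erWeight
  set q := Real.exp (-l)
  have hw : 0 < Real.sqrt (3 * q + 1) := Real.sqrt_pos.2 (by positivity)
  have hw2 : Real.sqrt (3 * q + 1) ^ 2 = 3 * q + 1 := Real.sq_sqrt (by positivity)
  set w := Real.sqrt (3 * q + 1)
  have key : 3 * q / (2 * w) ≤ 3 / 8 * w := by
    rw [div_le_iff₀ (by positivity)]
    nlinarith
  have hdiv : 3 * -q / (2 * w) = -(3 * q / (2 * w)) := by ring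
  rw [hdiv]
  nlinarith [mul_le_mul_of_nonneg_left key hpos.le]

/-- A function with nonnegative derivative on `[a, b]` is monotone there. -/
lemma monotoneOn_Icc_of_hasDerivAt_nonneg {f : ℝ → ℝ} {a b : ℝ}
    (h : ∀ x ∈ Set.Icc a b, ∃ d, HasDerivAt f d x ∧ 0 ≤ d) : MonotoneOn f (Set.Icc a b) := by
  refine monotoneOn_of_deriv_nonneg (convex_Icc a b) (fun x hx => ?_) (fun x hx => ?_)
    (fun x hx => ?_)
  · obtain ⟨d, hd, -⟩ := h x hx
    exact hd.continuousAt.continuousWithinAt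
  · obtain ⟨d, hd, -⟩ := h x (interior_subset hx)
    exact hd.differentiableAt.differentiableWithinAt
  · obtain ⟨d, hd, h0⟩ := h x (interior_subset hx)
    rwa [hd.deriv]

lemma monotoneOn_erWeight_mul_sq :
    MonotoneOn (fun l => erWeight l * l ^ 2) (Set.Icc (0 : ℝ) (4 / 3)) := by
  refine monotoneOn_Icc_of_hasDerivAt_nonneg fun l ⟨h0, h1⟩ => ?_
  obtain ⟨d, hd, hle⟩ := exists_hasDerivAt_erWeight h0
  refine ⟨_, hd.mul (hasDerivAt_pow 2 l), ?_⟩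
  have h2 := mul_le_mul_of_nonneg_right hle (sq_nonneg l)
  have h3 : 0 ≤ erWeight l * (l * (2 - 11 / 8 * l)) :=
    mul_nonneg (erWeight_nonneg l) (mul_nonneg h0 (by linarith))
  norm_num
  nlinarith

/-- The terms `k = 2, 3, 4` of `erSeries`. -/
noncomputable def erHead (l : ℝ) : ℝ :=
  Real.sqrt 2 / 2 * l ^ 2 + Real.sqrt 3 / 6 * l ^ 3 + 1 / 12 * l ^ 4

lemma le_polynomial_mul {l : ℝ} (h0 : 0 ≤ l) (h1 : l ≤ 4 / 3) :
    2 * (2 * l - 1) ≤ (7 / 5 * (l - 11 / 16 * l ^ 2) + 17 / 10 * (l ^ 2 / 2 - 11 / 48 * l ^ 3)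
      + (l ^ 3 / 3 - 11 / 96 * l ^ 4)) * (1 + l + l ^ 2 / 2) := by
  have hl2 : 0 ≤ l ^ 2 := sq_nonneg l
  have hA : 0 ≤ l - 11 / 16 * l ^ 2 := by nlinarith
  have hB : 7 / 36 * l ^ 2 ≤ l ^ 2 / 2 - 11 / 48 * l ^ 3 := by nlinarith
  have hC : 13 / 72 * l ^ 3 ≤ l ^ 3 / 3 - 11 / 96 * l ^ 4 := by nlinarith [pow_nonneg h0 3]
  have hR : 7 / 5 * (l - 11 / 16 * l ^ 2) + 17 / 10 * (7 / 36 * l ^ 2) + 13 / 72 * l ^ 3 ≤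
      7 / 5 * (l - 11 / 16 * l ^ 2) + 17 / 10 * (l ^ 2 / 2 - 11 / 48 * l ^ 3)
      + (l ^ 3 / 3 - 11 / 96 * l ^ 4) := by linarith
  refine le_trans ?_ (mul_le_mul_of_nonneg_right hR (by positivity))
  nlinarith [sq_nonneg (l - 1), mul_nonneg h0 (sq_nonneg (l - 1)), mul_nonneg hl2 (sq_nonneg (l - 1)),
    mul_nonneg (pow_nonneg h0 3) (sq_nonneg (l - 1)), mul_nonneg h0 (sub_nonneg.2 h1)]

lemma monotoneOn_head :
    MonotoneOn (fun l => 2 * l * Real.exp (-2 * l) + erWeight l * erHead l)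
      (Set.Icc (0 : ℝ) (4 / 3)) := by
  refine monotoneOn_Icc_of_hasDerivAt_nonneg fun l ⟨h0, h1⟩ => ?_
  obtain ⟨d, hd, hle⟩ := exists_hasDerivAt_erWeight h0
  have hp : HasDerivAt erHead
      (Real.sqrt 2 * l + Real.sqrt 3 / 2 * l ^ 2 + 1 / 3 * l ^ 3) l := by
    have := (((hasDerivAt_pow 2 l).const_mul (Real.sqrt 2 / 2)).add
      ((hasDerivAt_pow 3 l).const_mul (Real.sqrt 3 / 6))).add
      ((hasDerivAt_pow 4 l).const_mul (1 / 12))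
    refine this.congr_deriv ?_
    norm_num
    ring
  have he : HasDerivAt (fun x : ℝ => 2 * x * Real.exp (-2 * x))
      (2 * Real.exp (-2 * l) * (1 - 2 * l)) l := by
    have := ((hasDerivAt_id l).const_mul 2).mul (((hasDerivAt_id l).const_mul (-2)).exp)
    refine this.congr_deriv ?_
    simp
    ring
  refine ⟨_, he.add (hd.mul hp), ?_⟩
  have hsq : Real.exp (-2 * l) = Real.exp (-l) ^ 2 := by
    rw [← Real.exp_nat_mul]; congr 1; push_cast; ring
  have hhead : 0 ≤ erHead l := by unfold erHead; positivity
  have hexp : Real.exp (-l) * (1 + l + l ^ 2 / 2) ≤ 1 := by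
    have h := mul_le_mul_of_nonneg_left (Real.quadratic_le_exp_of_nonneg h0) (Real.exp_pos (-l)).le
    rwa [← Real.exp_add, neg_add_cancel, Real.exp_zero] at h
  have h2 : (7 / 5 : ℝ) ≤ Real.sqrt 2 := Real.le_sqrt_of_sq_le (by norm_num)
  have h3 : (17 / 10 : ℝ) ≤ Real.sqrt 3 := Real.le_sqrt_of_sq_le (by norm_num)
  have hA : 0 ≤ l - 11 / 16 * l ^ 2 := by nlinarith
  have hB : 0 ≤ l ^ 2 / 2 - 11 / 48 * l ^ 3 := by nlinarith [sq_nonneg l]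
  have hC : 0 ≤ l ^ 3 / 3 - 11 / 96 * l ^ 4 := by nlinarith [pow_nonneg h0 3]
  set R := 7 / 5 * (l - 11 / 16 * l ^ 2) + 17 / 10 * (l ^ 2 / 2 - 11 / 48 * l ^ 3)
      + (l ^ 3 / 3 - 11 / 96 * l ^ 4) with hR
  have hR0 : 0 ≤ R := by positivity
  have hRle : R ≤ (Real.sqrt 2 * l + Real.sqrt 3 / 2 * l ^ 2 + 1 / 3 * l ^ 3)
      - 11 / 8 * erHead l := by
    unfold erHead
    nlinarith [mul_le_mul_of_nonneg_right h2 hA, mul_le_mul_of_nonneg_right h3 hB]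
  have hqpos := Real.exp_pos (-l)
  have hqR : Real.exp (-l) * (2 * (2 * l - 1)) ≤ R := by
    have h4 := mul_le_mul_of_nonneg_left (le_polynomial_mul h0 h1) hqpos.le
    rw [← hR] at h4
    nlinarith [mul_le_mul_of_nonneg_left hexp hR0]
  rw [hsq]
  set q := Real.exp (-l)
  have h5 := mul_le_mul_of_nonneg_right hle hhead
  have h6 := mul_le_mul_of_nonneg_left hRle (erWeight_nonneg l)
  have h7 := mul_le_mul_of_nonneg_right (exp_neg_le_erWeight l) hR0
  have h8 := mul_le_mul_of_nonneg_left hqR hqpos.le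
  nlinarith

lemma summable_erSeries {l : ℝ} (hl : 0 ≤ l) :
    Summable fun k : ℕ =>
      l ^ (k + 2) * Real.sqrt ((k : ℝ) + 2) / (Nat.factorial (k + 2) : ℝ) := by
  have h := ((summable_nat_add_iff 1).2 (Real.summable_pow_div_factorial l)).mul_left l
  refine h.of_nonneg_of_le (fun k => by positivity) fun k => ?_
  have hs : Real.sqrt ((k : ℝ) + 2) ≤ (k : ℝ) + 2 :=
    Real.sqrt_le_self_iff.2 (Or.inr (by linarith [Nat.cast_nonneg (α := ℝ) k]))
  have hfac : (Nat.factorial (k + 2) : ℝ) = ((k : ℝ) + 2) * (Nat.factorial (k + 1) : ℝ) := by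
    rw [Nat.factorial_succ]; push_cast; ring
  calc l ^ (k + 2) * Real.sqrt ((k : ℝ) + 2) / (Nat.factorial (k + 2) : ℝ)
      ≤ l ^ (k + 2) * ((k : ℝ) + 2) / (Nat.factorial (k + 2) : ℝ) := by gcongr
    _ = l * (l ^ (k + 1) / (Nat.factorial (k + 1) : ℝ)) := by
      rw [hfac]; field_simp; ring

lemma erSeries_eq_head_add_tail {l : ℝ} (hl : 0 ≤ l) :
    erSeries l = erHead l + ∑' k : ℕ, l ^ (k + 3 + 2) * Real.sqrt (((k + 3 : ℕ) : ℝ) + 2) /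
      (Nat.factorial (k + 3 + 2) : ℝ) := by
  have h4 : Real.sqrt 4 = 2 := by
    rw [show (4 : ℝ) = 2 ^ 2 by norm_num]; exact Real.sqrt_sq (by norm_num)
  rw [erSeries, ← (summable_erSeries hl).sum_add_tsum_nat_add 3]
  congr 1
  norm_num [Finset.sum_range_succ, Nat.factorial, erHead, h4]
  ring

lemma monotoneOn_tail :
    MonotoneOn (fun l => erWeight l * ∑' k : ℕ, l ^ (k + 3 + 2) *
      Real.sqrt (((k + 3 : ℕ) : ℝ) + 2) / (Nat.factorial (k + 3 + 2) : ℝ))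
      (Set.Icc (0 : ℝ) (4 / 3)) := by
  intro x hx y hy hxy
  have hsum {l : ℝ} (hl : 0 ≤ l) := ((summable_nat_add_iff 3).2 (summable_erSeries hl)).mul_left
    (erWeight l)
  simp only [← tsum_mul_left]
  refine (hsum hx.1).tsum_le_tsum (fun k => ?_) (hsum hy.1)
  have h := mul_le_mul (monotoneOn_erWeight_mul_sq hx hy hxy)
    (pow_le_pow_left₀ hx.1 hxy (k + 3)) (pow_nonneg hx.1 _)
    (mul_nonneg (erWeight_nonneg y) (sq_nonneg y))
  have hc : 0 ≤ Real.sqrt (((k + 3 : ℕ) : ℝ) + 2) / (Nat.factorial (k + 3 + 2) : ℝ) := by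
    positivity
  calc _ = erWeight x * x ^ 2 * x ^ (k + 3) *
        (Real.sqrt (((k + 3 : ℕ) : ℝ) + 2) / (Nat.factorial (k + 3 + 2) : ℝ)) := by ring
    _ ≤ erWeight y * y ^ 2 * y ^ (k + 3) *
        (Real.sqrt (((k + 3 : ℕ) : ℝ) + 2) / (Nat.factorial (k + 3 + 2) : ℝ)) :=
      mul_le_mul_of_nonneg_right h hc
    _ = _ := by ring

/-- `f` is monotone increasing on `(0, 4/3]`. -/
theorem erBound_monotoneOn : MonotoneOn erBound (Set.Ioc (0 : ℝ) (4 / 3)) := by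
  refine ((monotoneOn_head.add monotoneOn_tail).mono Set.Ioc_subset_Icc_self).congr fun l hl => ?_
  rw [erBound, erSeries_eq_head_add_tail hl.1.le, ← erWeight]
  ring
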